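/- arXiv:2108.10124 — 6 statements merged into one kernel-verified Lean document; each statement's English description precedes it below -/
import Mathlib

section
/- For any finitely many points x^(1),...,x^(m) ∈ ℝ^n, the set of tropical Fermat–Weber points of x^(1),...,x^(m) is a convex subset of ℝ^n. -/
/-- Tropical distance on `ℝ^n`. -/
noncomputable def dtr {n : ℕ} (u v : Fin n → ℝ) : ℝ :=
  (⨆ i, (u i - v i)) - (⨅ i, (u i - v i))

/-- The tropical distance to a fixed point is a convex function. -/
theorem convexOn_dtr {n : ℕ} [Nonempty (Fin n)] (v : Fin n → ℝ) :
    ConvexOn ℝ Set.univ fun u : Fin n → ℝ => dtr u v := by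
  refine ⟨convex_univ, fun y _ z _ a b ha hb hab => ?_⟩
  have key (i : Fin n) :
      (a • y + b • z) i - v i = a * (y i - v i) + b * (z i - v i) := by
    simp only [Pi.add_apply, Pi.smul_apply, smul_eq_mul]
    linear_combination v i * hab
  have hsup (u : Fin n → ℝ) (i : Fin n) : u i - v i ≤ ⨆ j, (u j - v j) :=
    le_ciSup (f := fun j => u j - v j) (Set.finite_range _).bddAbove i
  have hinf (u : Fin n → ℝ) (i : Fin n) : ⨅ j, (u j - v j) ≤ u i - v i :=
    ciInf_le (f := fun j => u j - v j) (Set.finite_range _).bddBelow i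
  have hS : ⨆ i, ((a • y + b • z) i - v i) ≤
      a * (⨆ i, (y i - v i)) + b * ⨆ i, (z i - v i) := by
    refine ciSup_le fun i => ?_
    rw [key]
    exact add_le_add (mul_le_mul_of_nonneg_left (hsup y i) ha)
      (mul_le_mul_of_nonneg_left (hsup z i) hb)
  have hI : a * (⨅ i, (y i - v i)) + b * (⨅ i, (z i - v i)) ≤
      ⨅ i, ((a • y + b • z) i - v i) := by
    refine le_ciInf fun i => ?_
    rw [key]
    exact add_le_add (mul_le_mul_of_nonneg_left (hinf y i) ha)
      (mul_le_mul_of_nonneg_left (hinf z i) hb)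
  simp only [dtr, smul_eq_mul]
  linarith

/-- The set of tropical Fermat–Weber points of `x 1, …, x m` is a convex
subset of `ℝ^n`. -/
theorem tropical_fermat_weber_set_convex {n m : ℕ} (hn : 1 ≤ n) (hm : 1 ≤ m)
    (x : Fin m → Fin n → ℝ) :
    Convex ℝ {y : Fin n → ℝ | ∀ z : Fin n → ℝ,
      ∑ i, dtr y (x i) ≤ ∑ i, dtr z (x i)} := by
  have : Nonempty (Fin n) := ⟨⟨0, hn⟩⟩
  intro y hy z hz a b ha hb hab w
  calc ∑ i, dtr (a • y + b • z) (x i)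
      ≤ ∑ i, (a * dtr y (x i) + b * dtr z (x i)) :=
        Finset.sum_le_sum fun i _ =>
          (convexOn_dtr (x i)).2 (Set.mem_univ y) (Set.mem_univ z) ha hb hab
    _ = a * ∑ i, dtr y (x i) + b * ∑ i, dtr z (x i) := by
        rw [Finset.sum_add_distrib, Finset.mul_sum, Finset.mul_sum]
    _ ≤ a * ∑ i, dtr w (x i) + b * ∑ i, dtr w (x i) :=
        add_le_add (mul_le_mul_of_nonneg_left (hy w) ha)
          (mul_le_mul_of_nonneg_left (hz w) hb)
    _ = ∑ i, dtr w (x i) := by rw [← add_mul, hab, one_mul]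
end

section
/- Let F ∈ ℝ^n be a tropical Fermat–Weber point of x^(1),...,x^(m) ∈ ℝ^n. Then F is, up to adding constant vectors, the unique tropical Fermat–Weber point of the augmented family x^(1),...,x^(m), F: for every y ∈ ℝ^n, Σ_{i=1}^m d_tr(y, x^(i)) + d_tr(y, F) ≥ Σ_{i=1}^m d_tr(F, x^(i)), and equality holds only if y − F is a constant vector. -/
theorem sub_le_dtr {n : ℕ} (u v : Fin n → ℝ) (i j : Fin n) :
    (u i - v i) - (u j - v j) ≤ dtr u v :=
  sub_le_sub (le_ciSup (Set.finite_range fun k => u k - v k).bddAbove i)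
    (ciInf_le (Set.finite_range fun k => u k - v k).bddBelow j)

/-- If `F` is a tropical Fermat–Weber point of `x 1, …, x m`, then `F` is,
up to constant vectors, the unique Fermat–Weber point of the augmented family
`x 1, …, x m, F`: for every `y`,
`∑ i, d_tr(y, x i) + d_tr(y, F) ≥ ∑ i, d_tr(F, x i)`, with equality only if
`y - F` is a constant vector. -/
theorem fermat_weber_augmented_unique {n m : ℕ} (hn : 1 ≤ n) (hm : 1 ≤ m)
    (x : Fin m → Fin n → ℝ) (F : Fin n → ℝ)
    (hF : ∀ z : Fin n → ℝ, ∑ i, dtr F (x i) ≤ ∑ i, dtr z (x i)) :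
    ∀ y : Fin n → ℝ,
      (∑ i, dtr F (x i)) ≤ (∑ i, dtr y (x i)) + dtr y F ∧
      ((∑ i, dtr y (x i)) + dtr y F = ∑ i, dtr F (x i) →
        ∃ c : ℝ, ∀ i, y i - F i = c) := by
  intro y
  have i₀ : Fin n := ⟨0, hn⟩
  have hy := hF y
  have h_nonneg : 0 ≤ dtr y F := by simpa using sub_le_dtr y F i₀ i₀
  refine ⟨by linarith, fun h => ⟨y i₀ - F i₀, fun i => ?_⟩⟩
  have h₁ := sub_le_dtr y F i i₀
  have h₂ := sub_le_dtr y F i₀ i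
  linarith
end

section
/- With u^(1), u^(2), u^(3) defined as below, for every i ∈ {1,...,m} the projection coefficients λ_j := min_{1≤ℓ≤n}(x^(i)_ℓ − u^(j)_ℓ) satisfy: λ_1 = 0, λ_2 = x^(i)_{d2} − max_{1≤k≤m} x^(k)_{d2} − 1, and λ_3 = x^(i)_{d1} − max_{1≤k≤m} x^(k)_{d1} − 1. -/
/-- The first vertex `u^(1)`: `u 0 = 0`, `u d1 = min_k x k d1 - 1`,
`u d2 = min_k x k d2 - 1`, and `u j = t` elsewhere. -/
noncomputable def mkU1 {m n : ℕ} [NeZero n] (x : Fin m → Fin n → ℝ)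
    (d1 d2 : Fin n) (t : ℝ) : Fin n → ℝ :=
  fun j => if j = 0 then 0 else if j = d1 then (⨅ k, x k d1) - 1
    else if j = d2 then (⨅ k, x k d2) - 1 else t

/-- The second vertex `u^(2)`: `u 0 = 0`, `u d1 = min_k x k d1 + 1`,
`u d2 = max_k x k d2 + 1`, and `u j = t` elsewhere. -/
noncomputable def mkU2 {m n : ℕ} [NeZero n] (x : Fin m → Fin n → ℝ)
    (d1 d2 : Fin n) (t : ℝ) : Fin n → ℝ :=
  fun j => if j = 0 then 0 else if j = d1 then (⨅ k, x k d1) + 1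
    else if j = d2 then (⨆ k, x k d2) + 1 else t

/-- The third vertex `u^(3)`: `u 0 = 0`, `u d1 = max_k x k d1 + 1`,
`u d2 = min_k x k d2 + 1`, and `u j = t` elsewhere. -/
noncomputable def mkU3 {m n : ℕ} [NeZero n] (x : Fin m → Fin n → ℝ)
    (d1 d2 : Fin n) (t : ℝ) : Fin n → ℝ :=
  fun j => if j = 0 then 0 else if j = d1 then (⨆ k, x k d1) + 1
    else if j = d2 then (⨅ k, x k d2) + 1 else t

/-- A real infimum over a finite type equals any attained lower bound. -/
lemma ciInf_eq_of_forall_le_of_eq {ι : Type*} [Finite ι] {f : ι → ℝ} {b : ℝ}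
    (h : ∀ ℓ, b ≤ f ℓ) (i : ι) (hi : f i = b) : (⨅ ℓ, f ℓ) = b :=
  have : Nonempty ι := ⟨i⟩
  le_antisymm (hi ▸ ciInf_le (Set.finite_range f).bddBelow i) (le_ciInf h)

/-- The projection coefficients `λ_j = min_ℓ (x i ℓ - u^(j) ℓ)` onto the
special tropical triangle are `λ_1 = 0`, `λ_2 = x i d2 - max_k x k d2 - 1`,
and `λ_3 = x i d1 - max_k x k d1 - 1`. -/
theorem projection_coefficients {n m : ℕ} [NeZero n] (hn : 3 ≤ n) (hm : 1 ≤ m)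
    (d1 d2 : Fin n) (hd1 : (0 : Fin n) < d1) (hd12 : d1 < d2)
    (x : Fin m → Fin n → ℝ) (hx0 : ∀ k, x k 0 = 0)
    (t : ℝ) (ht : ∀ k j, t ≤ x k j) (i : Fin m) :
    (⨅ ℓ, (x i ℓ - mkU1 x d1 d2 t ℓ)) = 0 ∧
    (⨅ ℓ, (x i ℓ - mkU2 x d1 d2 t ℓ)) = x i d2 - (⨆ k, x k d2) - 1 ∧
    (⨅ ℓ, (x i ℓ - mkU3 x d1 d2 t ℓ)) = x i d1 - (⨆ k, x k d1) - 1 := by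
  have hmin (j : Fin n) : (⨅ k, x k j) ≤ x i j :=
    ciInf_le (Set.finite_range fun k => x k j).bddBelow i
  have hmax (j : Fin n) : x i j ≤ ⨆ k, x k j :=
    le_ciSup (Set.finite_range fun k => x k j).bddAbove i
  have h10 : d1 ≠ 0 := hd1.ne'
  have h20 : d2 ≠ 0 := (hd1.trans hd12).ne'
  have h21 : d2 ≠ d1 := hd12.ne'
  refine ⟨ciInf_eq_of_forall_le_of_eq (fun ℓ => ?_) 0 (by simp [mkU1, hx0]),
    ciInf_eq_of_forall_le_of_eq (fun ℓ => ?_) d2 ?_,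
    ciInf_eq_of_forall_le_of_eq (fun ℓ => ?_) d1 ?_⟩
  · have := ht i ℓ
    have := hmin d1
    have := hmin d2
    unfold mkU1
    split_ifs <;> subst_vars <;> linarith [hx0 i]
  · have := ht i ℓ
    have := hmin d1
    have := hmax d2
    unfold mkU2
    split_ifs <;> subst_vars <;> linarith [hx0 i]
  · simp only [mkU2, h20, h21, if_true, if_false]
    ring
  · have := ht i ℓ
    have := hmin d2
    have := hmax d1
    unfold mkU3
    split_ifs <;> subst_vars <;> linarith [hx0 i]
  · simp only [mkU3, h10, if_true, if_false]
    ring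
end

section
/- With u^(1), u^(2), u^(3) defined as below and C = tconv{u^(1), u^(2), u^(3)}, the tropical projection of each data point onto C projects it 'vertically': for every k ∈ {1,...,m}, δ_C(x^(k))_1 = 0, δ_C(x^(k))_{d1} = x^(k)_{d1}, δ_C(x^(k))_{d2} = x^(k)_{d2}, and δ_C(x^(k))_j = t for every j ∉ {1, d1, d2}. -/
/-- Tropical projection onto the tropical convex hull of three points:
`δ_C(x) j = max_{i=1,2,3} (λ_i + u^(i) j)`, where
`λ_i = min_ℓ (x ℓ - u^(i) ℓ)`. -/
noncomputable def proj3 {n : ℕ} (u1 u2 u3 : Fin n → ℝ) (x : Fin n → ℝ) : Fin n → ℝ :=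
  fun j => max ((⨅ ℓ, (x ℓ - u1 ℓ)) + u1 j)
    (max ((⨅ ℓ, (x ℓ - u2 ℓ)) + u2 j) ((⨅ ℓ, (x ℓ - u3 ℓ)) + u3 j))

/-- An infimum over a finite type that is attained at `i` equals the value at `i`. -/
theorem ciInf_eq_of_forall_apply_le {ι : Type*} [Finite ι] {f : ι → ℝ} (i : ι)
    (h : ∀ j, f i ≤ f j) : ⨅ j, f j = f i :=
  haveI : Nonempty ι := ⟨i⟩
  le_antisymm (ciInf_le (Set.finite_range f).bddBelow i) (le_ciInf h)

/-- The tropical projection onto the special tropical triangle projects each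
data point "vertically": it keeps coordinates `d1` and `d2`, is `0` at the
first coordinate, and is `t` at all other coordinates. -/
theorem projection_is_vertical {n m : ℕ} [NeZero n] (hn : 3 ≤ n) (hm : 1 ≤ m)
    (d1 d2 : Fin n) (hd1 : (0 : Fin n) < d1) (hd12 : d1 < d2)
    (x : Fin m → Fin n → ℝ) (hx0 : ∀ k, x k 0 = 0)
    (t : ℝ) (ht : ∀ k j, t ≤ x k j) (k : Fin m) :
    proj3 (mkU1 x d1 d2 t) (mkU2 x d1 d2 t) (mkU3 x d1 d2 t) (x k) 0 = 0 ∧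
    proj3 (mkU1 x d1 d2 t) (mkU2 x d1 d2 t) (mkU3 x d1 d2 t) (x k) d1 = x k d1 ∧
    proj3 (mkU1 x d1 d2 t) (mkU2 x d1 d2 t) (mkU3 x d1 d2 t) (x k) d2 = x k d2 ∧
    ∀ j : Fin n, j ≠ 0 → j ≠ d1 → j ≠ d2 →
      proj3 (mkU1 x d1 d2 t) (mkU2 x d1 d2 t) (mkU3 x d1 d2 t) (x k) j = t := by
  have hd1' : d1 ≠ 0 := hd1.ne'
  have hd2' : d2 ≠ 0 := (hd1.trans hd12).ne'
  have hd21 : d2 ≠ d1 := hd12.ne'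
  have inf_le (d : Fin n) : ⨅ k, x k d ≤ x k d :=
    ciInf_le (Set.finite_range fun k => x k d).bddBelow k
  have le_sup (d : Fin n) : x k d ≤ ⨆ k, x k d :=
    le_ciSup (Set.finite_range fun k => x k d).bddAbove k
  have i1 := inf_le d1
  have i2 := inf_le d2
  have s1 := le_sup d1
  have s2 := le_sup d2
  have h0 := hx0 k
  have coeff1 : ⨅ l, (x k l - mkU1 x d1 d2 t l) = 0 := by
    rw [ciInf_eq_of_forall_apply_le 0]
    · simp [mkU1, h0]
    · intro j
      have := ht k j
      simp only [mkU1, if_true, h0]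
      split_ifs <;> subst_vars <;> linarith
  have coeff2 : ⨅ l, (x k l - mkU2 x d1 d2 t l) = x k d2 - ((⨆ k, x k d2) + 1) := by
    rw [ciInf_eq_of_forall_apply_le d2]
    · simp [mkU2, hd2', hd21]
    · intro j
      have := ht k j
      simp only [mkU2, if_true, hd2', hd21, if_false]
      split_ifs <;> subst_vars <;> linarith
  have coeff3 : ⨅ l, (x k l - mkU3 x d1 d2 t l) = x k d1 - ((⨆ k, x k d1) + 1) := by
    rw [ciInf_eq_of_forall_apply_le d1]
    · simp [mkU3, hd1']
    · intro j
      have := ht k j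
      simp only [mkU3, if_true, hd1', if_false]
      split_ifs <;> subst_vars <;> linarith
  simp only [proj3, coeff1, coeff2, coeff3]
  refine ⟨?_, ?_, ?_, fun j hj0 hj1 hj2 => ?_⟩
  · simp only [mkU1, mkU2, mkU3, if_true]
    rw [max_eq_left (max_le _ _)] <;> linarith
  · simp only [mkU1, mkU2, mkU3, if_true, hd1', if_false]
    rw [max_eq_right (le_max_of_le_right _), max_eq_right] <;> linarith
  · simp only [mkU1, mkU2, mkU3, if_true, hd2', hd21, if_false]
    rw [max_eq_right (le_max_of_le_left _), max_eq_left] <;> linarith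
  · simp only [mkU1, mkU2, mkU3, hj0, hj1, hj2, if_false]
    rw [max_eq_left (max_le _ _)] <;> linarith
end

section
/- Let f ∈ ℝ^n with f_1 = 0 be a tropical Fermat–Weber point of the projected rows p^(1),...,p^(m), and define r ∈ ℝ^n by r_1 = 0, r_{d1} = f_{d1}, r_{d2} = f_{d2}, and r_j = t for every j ∉ {1, d1, d2}. Then r is a tropical Fermat–Weber point of p^(1),...,p^(m). -/
/-- If every coordinate of `u - v` is a coordinate of `u' - v'`, then
`dtr u v ≤ dtr u' v'`. -/
lemma dtr_le_dtr_of_forall_exists {n : ℕ} [NeZero n] {u v u' v' : Fin n → ℝ}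
    (h : ∀ j, ∃ i, u j - v j = u' i - v' i) : dtr u v ≤ dtr u' v' := by
  refine sub_le_sub (ciSup_le fun j => ?_) (le_ciInf fun j => ?_)
  · obtain ⟨i, hi⟩ := h j
    exact hi.trans_le (le_ciSup (f := fun i => u' i - v' i) (Set.finite_range _).bddAbove i)
  · obtain ⟨i, hi⟩ := h j
    exact (ciInf_le (f := fun i => u' i - v' i) (Set.finite_range _).bddBelow i).trans_eq hi.symm

/-- If `f` (with `f 0 = 0`) is a Fermat–Weber point of the projected rows
`p 1, …, p m`, then the point `r` with `r 0 = 0`, `r d1 = f d1`,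
`r d2 = f d2`, and `r j = t` elsewhere, is also a Fermat–Weber point of
`p 1, …, p m`. -/
theorem flattened_point_is_fermat_weber {n m : ℕ} [NeZero n] (hn : 3 ≤ n) (hm : 1 ≤ m)
    (d1 d2 : Fin n) (hd1 : (0 : Fin n) < d1) (hd12 : d1 < d2)
    (x : Fin m → Fin n → ℝ) (hx0 : ∀ k, x k 0 = 0)
    (t : ℝ) (ht : t = ⨅ k, ⨅ j, x k j)
    (p : Fin m → Fin n → ℝ)
    (hp : ∀ k j, p k j =
      if j = 0 then 0 else if j = d1 then x k d1 else if j = d2 then x k d2 else t)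
    (f : Fin n → ℝ) (hf0 : f 0 = 0)
    (hf : ∀ z : Fin n → ℝ, ∑ i, dtr f (p i) ≤ ∑ i, dtr z (p i))
    (r : Fin n → ℝ)
    (hr : ∀ j, r j =
      if j = 0 then 0 else if j = d1 then f d1 else if j = d2 then f d2 else t) :
    ∀ z : Fin n → ℝ, ∑ i, dtr r (p i) ≤ ∑ i, dtr z (p i) := by
  refine fun z => (Finset.sum_le_sum fun k _ => dtr_le_dtr_of_forall_exists fun j => ?_).trans (hf z)
  by_cases h : j = d1 ∨ j = d2
  · exact ⟨j, by grind⟩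
  · exact ⟨0, by grind⟩
end

section
/- Let f ∈ ℝ^n with f_1 = 0, and for each i ∈ {1,...,m} set A_i := min{0, f_{d1} − x^(i)_{d1}, f_{d2} − x^(i)_{d2}} and B_i := max{0, f_{d1} − x^(i)_{d1}, f_{d2} − x^(i)_{d2}}. Define r ∈ ℝ^n by r_1 = 0, r_{d1} = f_{d1}, r_{d2} = f_{d2}, and r_j = t for j ∉ {1, d1, d2}. Then d_tr(p^(i), r) = B_i − A_i for every i, and hence Σ_{i=1}^m d_tr(p^(i), r) = Σ_{i=1}^m (B_i − A_i). -/
theorem dtr_eq_of_isGreatest_of_isLeast {n : ℕ} {u v : Fin n → ℝ} {a b : ℝ}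
    (ha : IsGreatest (Set.range fun i => u i - v i) a)
    (hb : IsLeast (Set.range fun i => u i - v i) b) : dtr u v = a - b :=
  congrArg₂ (· - ·) ha.csSup_eq hb.csInf_eq

/-- If the difference `u - v` is supported on two coordinates and vanishes at a third one, the
tropical distance only depends on its values at the two coordinates. -/
theorem dtr_eq_of_sub_eq_zero {n : ℕ} {u v : Fin n → ℝ} {o d e : Fin n}
    (ho : u o - v o = 0) (h : ∀ j, j ≠ d → j ≠ e → u j - v j = 0) :
    dtr u v = max 0 (max (u d - v d) (u e - v e)) - min 0 (min (u d - v d) (u e - v e)) := by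
  have hj (j : Fin n) : u j - v j = 0 ∨ u j - v j = u d - v d ∨ u j - v j = u e - v e := by
    by_cases hd : j = d
    · simp [hd]
    by_cases he : j = e
    · simp [he]
    exact .inl (h j hd he)
  apply dtr_eq_of_isGreatest_of_isLeast
  · constructor
    · rcases max_choice 0 (max (u d - v d) (u e - v e)) with h | h
      · exact ⟨o, ho.trans h.symm⟩
      rcases max_choice (u d - v d) (u e - v e) with h' | h'
      · exact ⟨d, (h.trans h').symm⟩
      · exact ⟨e, (h.trans h').symm⟩
    · rintro _ ⟨j, rfl⟩
      rcases hj j with h | h | h <;> simp [h]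
  · constructor
    · rcases min_choice 0 (min (u d - v d) (u e - v e)) with h | h
      · exact ⟨o, ho.trans h.symm⟩
      rcases min_choice (u d - v d) (u e - v e) with h' | h'
      · exact ⟨d, (h.trans h').symm⟩
      · exact ⟨e, (h.trans h').symm⟩
    · rintro _ ⟨j, rfl⟩
      rcases hj j with h | h | h <;> simp [h]

/-- With `A i = min {0, f d1 - x i d1, f d2 - x i d2}` and
`B i = max {0, f d1 - x i d1, f d2 - x i d2}`, and `r` the point agreeing
with `f` at coordinates `d1, d2`, equal to `0` at the first coordinate and to
`t` elsewhere, one has `d_tr(p i, r) = B i - A i` for every `i`, and hence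
`∑ i, d_tr(p i, r) = ∑ i, (B i - A i)`. -/
theorem dist_to_flattened_point {n m : ℕ} [NeZero n] (hn : 3 ≤ n) (hm : 1 ≤ m)
    (d1 d2 : Fin n) (hd1 : (0 : Fin n) < d1) (hd12 : d1 < d2)
    (x : Fin m → Fin n → ℝ) (hx0 : ∀ k, x k 0 = 0)
    (t : ℝ) (ht : t = ⨅ k, ⨅ j, x k j)
    (p : Fin m → Fin n → ℝ)
    (hp : ∀ k j, p k j =
      if j = 0 then 0 else if j = d1 then x k d1 else if j = d2 then x k d2 else t)
    (f : Fin n → ℝ) (hf0 : f 0 = 0)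
    (A B : Fin m → ℝ)
    (hA : ∀ i, A i = min 0 (min (f d1 - x i d1) (f d2 - x i d2)))
    (hB : ∀ i, B i = max 0 (max (f d1 - x i d1) (f d2 - x i d2)))
    (r : Fin n → ℝ)
    (hr : ∀ j, r j =
      if j = 0 then 0 else if j = d1 then f d1 else if j = d2 then f d2 else t) :
    (∀ i, dtr (p i) r = B i - A i) ∧
    ∑ i, dtr (p i) r = ∑ i, (B i - A i) := by
  have key (i : Fin m) : dtr (p i) r = B i - A i := by
    have h1 : p i d1 - r d1 = -(f d1 - x i d1) := by
      simp [hp, hr, hd1.ne']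
    have h2 : p i d2 - r d2 = -(f d2 - x i d2) := by
      simp [hp, hr, (hd1.trans hd12).ne', hd12.ne']
    rw [dtr_eq_of_sub_eq_zero (o := 0) (d := d1) (e := d2) (by simp [hp, hr])
      (fun j hj1 hj2 => by simp [hp, hr, hj1, hj2]), h1, h2, hA, hB, max_neg_neg, min_neg_neg,
      ← neg_zero, max_neg_neg, min_neg_neg, neg_zero]
    ring
  exact ⟨key, Finset.sum_congr rfl fun i _ => key i⟩
end
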